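/- arXiv:1009.2135 — 5 statements merged into one kernel-verified Lean document; each statement's English description precedes it below -/
import Mathlib

section
/- For all nonzero real numbers t_1, t_2, t_3 with t_1+t_2 ≠ 0, t_1+t_3 ≠ 0, t_2+t_3 ≠ 0, the sum of contributions of the three types of ribbon graphs of type (0,3) equals the closed form: −( z(t_1,t_1)z(t_1,t_2)z(t_1,t_3) + z(t_2,t_2)z(t_2,t_1)z(t_2,t_3) + z(t_3,t_3)z(t_3,t_1)z(t_3,t_2) ) + ( z(t_1,t_2)z(t_1,t_3) + z(t_2,t_1)z(t_2,t_3) + z(t_3,t_1)z(t_3,t_2) ) − z(t_1,t_2)z(t_1,t_3)z(t_2,t_3) = −(1/16)·(t_1+1)(t_2+1)(t_3+1)·(1 + 1/(t_1 t_2 t_3)). -/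
/-- For real numbers `a`, `b` with `a + b ≠ 0`, `z a b = (a+1)(b+1)/(2(a+b))`. -/
noncomputable def z (a b : ℝ) : ℝ := (a + 1) * (b + 1) / (2 * (a + b))

/-- The Poincaré polynomial `F_{0,3}`: the sum of the contributions of the three
ribbon graphs of type `(0,3)` (dumbbell, infinity sign, theta graph) equals the
closed form `−(1/16)(t₁+1)(t₂+1)(t₃+1)(1 + 1/(t₁t₂t₃))`. -/
theorem F03_closed_form (t1 t2 t3 : ℝ) (h1 : t1 ≠ 0) (h2 : t2 ≠ 0) (h3 : t3 ≠ 0)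
    (h12 : t1 + t2 ≠ 0) (h13 : t1 + t3 ≠ 0) (h23 : t2 + t3 ≠ 0) :
    -(z t1 t1 * z t1 t2 * z t1 t3 + z t2 t2 * z t2 t1 * z t2 t3 +
          z t3 t3 * z t3 t1 * z t3 t2) +
        (z t1 t2 * z t1 t3 + z t2 t1 * z t2 t3 + z t3 t1 * z t3 t2) -
        z t1 t2 * z t1 t3 * z t2 t3 =
      -(1 / 16) * (t1 + 1) * (t2 + 1) * (t3 + 1) * (1 + 1 / (t1 * t2 * t3)) := by
  simp only [z, add_comm t2 t1, add_comm t3 t1, add_comm t3 t2, ← two_mul]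
  field_simp
  ring
end

section
/- Let f be a Laurent polynomial in one variable over ℝ all of whose monomials have odd exponent. Then there exists a Laurent polynomial P in two variables x, y over ℝ, all of whose monomials have even exponent in x and odd exponent in y, such that the identity of rational functions y · ( ((x²−1)³/x²)·f′(x) − ((y²−1)³/y²)·f′(y) ) = (x² − y²) · P(x,y) holds; in particular the expression (y/(x²−y²)) · ( ((x²−1)³/x²)·f′(x) − ((y²−1)³/y²)·f′(y) ) is a Laurent polynomial in x and y. -/
/-- Functions of two variables that agree, off the coordinate axes, with `x² - y²` times a Laurent
polynomial all of whose monomials are even in `x` and odd in `y`. -/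
def laurentMultiples : Submodule ℝ (ℝ → ℝ → ℝ) where
  carrier := {h | ∃ P ∈ Finsupp.supported ℝ ℝ {p : ℤ × ℤ | Even p.1 ∧ Odd p.2},
    ∀ x y : ℝ, x ≠ 0 → y ≠ 0 →
      h x y = (x ^ 2 - y ^ 2) * (P.sum fun p a => a * x ^ p.1 * y ^ p.2)}
  zero_mem' := ⟨0, zero_mem _, by simp⟩
  add_mem' := by
    rintro g h ⟨P, hP, hg⟩ ⟨Q, hQ, hh⟩
    refine ⟨P + Q, add_mem hP hQ, fun x y hx hy => ?_⟩
    rw [Finsupp.sum_add_index' (by simp) (by intros; ring), mul_add, ← hg x y hx hy,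
      ← hh x y hx hy]
    rfl
  smul_mem' := by
    rintro r h ⟨P, hP, hh⟩
    refine ⟨r • P, Submodule.smul_mem _ r hP, fun x y hx hy => ?_⟩
    rw [Finsupp.sum_smul_index (by simp), Pi.smul_apply, Pi.smul_apply, hh x y hx hy, smul_eq_mul]
    simp only [Finsupp.sum, Finset.mul_sum]
    exact Finset.sum_congr rfl fun _ _ => by ring

lemma laurentMultiples_congr {g h : ℝ → ℝ → ℝ} (hg : g ∈ laurentMultiples)
    (hgh : ∀ x y : ℝ, x ≠ 0 → y ≠ 0 → h x y = g x y) : h ∈ laurentMultiples := by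
  obtain ⟨P, hP, hg⟩ := hg
  exact ⟨P, hP, fun x y hx hy => (hgh x y hx hy).trans (hg x y hx hy)⟩

lemma monomial_mem_laurentMultiples {m n : ℤ} (hm : Even m) (hn : Odd n) :
    (fun x y : ℝ => (x ^ 2 - y ^ 2) * (x ^ m * y ^ n)) ∈ laurentMultiples :=
  ⟨Finsupp.single (m, n) 1, Finsupp.single_mem_supported ℝ 1 ⟨hm, hn⟩, by simp⟩

lemma zpow_mul_sub_mem_laurentMultiples (k : ℤ) {j : ℤ} (hj : Odd j) :
    (fun x y : ℝ => y ^ j * (x ^ (2 * k) - y ^ (2 * k))) ∈ laurentMultiples := by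
  induction k generalizing j with
  | zero => exact laurentMultiples_congr (zero_mem _) (by simp)
  | succ k ih =>
    refine laurentMultiples_congr (add_mem (ih (hj.add_even even_two))
      (monomial_mem_laurentMultiples (even_two_mul (k : ℤ)) hj)) fun x y hx hy => ?_
    simp only [Pi.add_apply, mul_add, zpow_add₀ hx, zpow_add₀ hy, mul_one, zpow_ofNat]
    ring
  | pred k ih =>
    refine laurentMultiples_congr (sub_mem (ih (hj.sub_even even_two))
      (monomial_mem_laurentMultiples (even_two_mul (-(k : ℤ) - 1)) (hj.sub_even even_two)))
      fun x y hx hy => ?_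
    simp only [Pi.sub_apply, mul_sub, zpow_sub₀ hx, zpow_sub₀ hy, mul_one, zpow_ofNat]
    field_simp
    ring

lemma odd_monomial_mem_laurentMultiples {n : ℤ} (hn : Odd n) :
    (fun x y : ℝ => y * ((x ^ 2 - 1) ^ 3 / x ^ 2 * x ^ (n - 1) -
      (y ^ 2 - 1) ^ 3 / y ^ 2 * y ^ (n - 1))) ∈ laurentMultiples := by
  obtain ⟨m, rfl⟩ := hn
  have key (k : ℤ) := zpow_mul_sub_mem_laurentMultiples k odd_one
  refine laurentMultiples_congr (sub_mem (add_mem (sub_mem (key (m + 2))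
    (Submodule.smul_mem _ 3 (key (m + 1)))) (Submodule.smul_mem _ 3 (key m))) (key (m - 1)))
    fun x y hx hy => ?_
  simp only [Pi.add_apply, Pi.sub_apply, Pi.smul_apply, smul_eq_mul, mul_add, mul_sub,
    add_sub_cancel_right, zpow_add₀ hx, zpow_add₀ hy, zpow_sub₀ hx, zpow_sub₀ hy, mul_one,
    zpow_ofNat, Int.reduceMul]
  field_simp
  ring

/-- Let `f` be a Laurent polynomial in one variable over `ℝ` (given by its finitely
supported coefficient function `c : ℤ →₀ ℝ`, so `f(x) = Σ cₙ xⁿ` and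
`f′(x) = Σ cₙ n x^{n−1}`) all of whose monomials have odd exponent. Then there is a
Laurent polynomial `P` in two variables, all of whose monomials have even exponent in
`x` and odd exponent in `y`, with
`y·( ((x²−1)³/x²)·f′(x) − ((y²−1)³/y²)·f′(y) ) = (x²−y²)·P(x,y)`
as rational functions; in particular
`(y/(x²−y²))·( ((x²−1)³/x²)·f′(x) − ((y²−1)³/y²)·f′(y) )` is a Laurent polynomial. -/
theorem laurent_division_lemma (c : ℤ →₀ ℝ) (hodd : ∀ n ∈ c.support, Odd n) :
    ∃ P : ℤ × ℤ →₀ ℝ,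
      (∀ p ∈ P.support, Even p.1 ∧ Odd p.2) ∧
      ∀ x y : ℝ, x ≠ 0 → y ≠ 0 →
        y * (((x ^ 2 - 1) ^ 3 / x ^ 2) * (c.sum fun n a => a * (n : ℝ) * x ^ (n - 1)) -
            ((y ^ 2 - 1) ^ 3 / y ^ 2) * (c.sum fun n a => a * (n : ℝ) * y ^ (n - 1))) =
          (x ^ 2 - y ^ 2) * (P.sum fun p a => a * x ^ p.1 * y ^ p.2) := by
  have hmem : (∑ n ∈ c.support, (c n * n) • fun x y : ℝ =>
      y * ((x ^ 2 - 1) ^ 3 / x ^ 2 * x ^ (n - 1) - (y ^ 2 - 1) ^ 3 / y ^ 2 * y ^ (n - 1))) ∈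
      laurentMultiples :=
    sum_mem fun n hn => Submodule.smul_mem _ _ (odd_monomial_mem_laurentMultiples (hodd n hn))
  obtain ⟨P, hP, h⟩ := hmem
  refine ⟨P, fun p hp => hP hp, fun x y hx hy => ?_⟩
  rw [← h x y hx hy]
  simp only [Finsupp.sum, Finset.sum_apply, Pi.smul_apply, smul_eq_mul, Finset.mul_sum,
    ← Finset.sum_sub_distrib]
  exact Finset.sum_congr rfl fun _ _ => by ring
end

section
/- The closed formula F04 satisfies the (g,n) = (0,4) case of the differential topological recursion with input F03: for all nonzero real t_1, t_2, t_3, t_4 with t_1² ≠ t_j² for j = 2,3,4, ∂F04/∂t_1 (t_1,t_2,t_3,t_4) = −(1/16) Σ_{j=2}^{4} [ (t_j/(t_1²−t_j²)) · ( ((t_1²−1)³/t_1²) · ∂_1 F03(t_1, t_k, t_l) − ((t_j²−1)³/t_j²) · ∂_{t_j} F03(t_2,t_3,t_4) ) + ((t_1²−1)²/t_1²) · ∂_1 F03(t_1, t_k, t_l) ], where for each j ∈ {2,3,4}, {k,l} = {2,3,4}∖{j}, and ∂_1 denotes the partial derivative in the first argument. -/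
/-- The Poincaré polynomial `F_{0,3}` of `RG_{0,3}`. -/
noncomputable def F03 (t1 t2 t3 : ℝ) : ℝ :=
  -(1 / 16) * (t1 + 1) * (t2 + 1) * (t3 + 1) * (1 + 1 / (t1 * t2 * t3))

/-- The Poincaré polynomial `F_{0,4}` of `RG_{0,4}`. -/
noncomputable def F04 (t1 t2 t3 t4 : ℝ) : ℝ :=
  (1 / 256) * (t1 + 1) * (t2 + 1) * (t3 + 1) * (t4 + 1) *
    ((t1 ^ 2 + t2 ^ 2 + t3 ^ 2 + t4 ^ 2) - (t1 + t2 + t3 + t4) - 5 -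
      (1 / (t1 * t2) + 1 / (t1 * t3) + 1 / (t1 * t4) + 1 / (t2 * t3) +
        1 / (t2 * t4) + 1 / (t3 * t4)) +
      (1 / (t1 * t2 * t3 * t4)) *
        (-5 - (1 / t1 + 1 / t2 + 1 / t3 + 1 / t4) +
          (1 / t1 ^ 2 + 1 / t2 ^ 2 + 1 / t3 ^ 2 + 1 / t4 ^ 2)))

/-- `F03` is symmetric under exchanging its first two arguments. -/
theorem F03_swap_left (a b c : ℝ) : F03 a b c = F03 b a c := by
  simp only [F03, mul_comm a b]
  ring

/-- `F03` is invariant under cyclic rotation of its arguments. -/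
theorem F03_rotate (a b c : ℝ) : F03 a b c = F03 c a b := by
  simp only [F03, show c * a * b = a * b * c by ring]
  ring

theorem deriv_F03 {a : ℝ} (b c : ℝ) (ha : a ≠ 0) :
    deriv (fun s => F03 s b c) a =
      -(1 / 16) * ((b + 1) * (c + 1) * (1 - a⁻¹ ^ 2 * b⁻¹ * c⁻¹)) := by
  have hF : (fun s => F03 s b c) = fun s =>
      -(1 / 16) * ((b + 1) * (c + 1) * ((s + 1) * (1 + s⁻¹ * (b⁻¹ * c⁻¹)))) := by
    funext s
    simp only [F03, one_div, mul_inv]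
    ring
  rw [hF]
  have h := (((((hasDerivAt_id' a).add_const 1).mul
    (((hasDerivAt_inv ha).mul_const (b⁻¹ * c⁻¹)).const_add 1)).const_mul
      ((b + 1) * (c + 1))).const_mul (-(1 / 16)))
  refine h.deriv.trans ?_
  by_cases hb : b = 0
  · simp [hb]
  by_cases hc : c = 0
  · simp [hc]
  field_simp
  ring

theorem deriv_F04 {a b c d : ℝ} (ha : a ≠ 0) :
    deriv (fun s => F04 s b c d) a =
      1 / 256 * ((b + 1) * (c + 1) * (d + 1)) *
        ((a ^ 2 + b ^ 2 + c ^ 2 + d ^ 2 - (a + b + c + d) - 5 -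
            (a⁻¹ * (b⁻¹ + c⁻¹ + d⁻¹) + (b⁻¹ * c⁻¹ + b⁻¹ * d⁻¹ + c⁻¹ * d⁻¹)) +
            b⁻¹ * c⁻¹ * d⁻¹ * (a⁻¹ * (-5 - (b⁻¹ + c⁻¹ + d⁻¹) + (b⁻¹ ^ 2 + c⁻¹ ^ 2 + d⁻¹ ^ 2)) -
              a⁻¹ ^ 2 + a⁻¹ ^ 3)) +
          (a + 1) * (2 * a - 1 + a⁻¹ ^ 2 * (b⁻¹ + c⁻¹ + d⁻¹) +
            b⁻¹ * c⁻¹ * d⁻¹ *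
              (-a⁻¹ ^ 2 * (-5 - (b⁻¹ + c⁻¹ + d⁻¹) + (b⁻¹ ^ 2 + c⁻¹ ^ 2 + d⁻¹ ^ 2)) +
                2 * a⁻¹ ^ 3 - 3 * a⁻¹ ^ 4))) := by
  have hF : (fun s => F04 s b c d) = fun s =>
      1 / 256 * ((b + 1) * (c + 1) * (d + 1)) * ((s + 1) *
        (s ^ 2 - s + (b ^ 2 + c ^ 2 + d ^ 2 - (b + c + d) - 5 -
            (b⁻¹ * c⁻¹ + b⁻¹ * d⁻¹ + c⁻¹ * d⁻¹)) +
          (s⁻¹ * (b⁻¹ * c⁻¹ * d⁻¹ * (-5 - (b⁻¹ + c⁻¹ + d⁻¹) + (b⁻¹ ^ 2 + c⁻¹ ^ 2 + d⁻¹ ^ 2)) -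
              (b⁻¹ + c⁻¹ + d⁻¹)) +
            (s⁻¹ ^ 3 - s⁻¹ ^ 2) * (b⁻¹ * c⁻¹ * d⁻¹)))) := by
    funext s
    simp only [F04, one_div, mul_inv, inv_pow]
    ring
  rw [hF]
  have hid := hasDerivAt_id' a
  have hinv := hasDerivAt_inv ha
  have h := ((hid.add_const 1).mul ((((hid.pow 2).sub hid).add_const
    (b ^ 2 + c ^ 2 + d ^ 2 - (b + c + d) - 5 - (b⁻¹ * c⁻¹ + b⁻¹ * d⁻¹ + c⁻¹ * d⁻¹))).add
    ((hinv.mul_const (b⁻¹ * c⁻¹ * d⁻¹ *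
        (-5 - (b⁻¹ + c⁻¹ + d⁻¹) + (b⁻¹ ^ 2 + c⁻¹ ^ 2 + d⁻¹ ^ 2)) - (b⁻¹ + c⁻¹ + d⁻¹))).add
      (((hinv.pow 3).sub (hinv.pow 2)).mul_const (b⁻¹ * c⁻¹ * d⁻¹))))).const_mul
    (1 / 256 * ((b + 1) * (c + 1) * (d + 1)))
  refine h.deriv.trans ?_
  simp only [div_eq_mul_inv, Pi.add_apply, Pi.sub_apply, Pi.pow_apply, ← inv_pow]
  push_cast
  ring

/-- The summand of the recursion attached to the pair `(a, b)` is a Laurent polynomial. -/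
theorem F03_recursion_summand {a b : ℝ} (c d : ℝ) (ha : a ≠ 0) (hb : b ≠ 0)
    (hab : a ^ 2 ≠ b ^ 2) :
    b / (a ^ 2 - b ^ 2) *
        (((a ^ 2 - 1) ^ 3 / a ^ 2) * deriv (fun s => F03 s c d) a -
          ((b ^ 2 - 1) ^ 3 / b ^ 2) * deriv (fun s => F03 s c d) b) +
        ((a ^ 2 - 1) ^ 2 / a ^ 2) * deriv (fun s => F03 s c d) a =
      -(1 / 16) * ((c + 1) * (d + 1)) *
        (b * (a ^ 2 + b ^ 2 - 3 + a⁻¹ ^ 2 * b⁻¹ ^ 2 -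
            c⁻¹ * d⁻¹ * (1 - 3 * a⁻¹ ^ 2 * b⁻¹ ^ 2 +
              (a⁻¹ ^ 2 * b⁻¹ ^ 4 + a⁻¹ ^ 4 * b⁻¹ ^ 2))) +
          (a ^ 2 - 2 + a⁻¹ ^ 2) * (1 - a⁻¹ ^ 2 * (c⁻¹ * d⁻¹))) := by
  have hab' : a ^ 2 - b ^ 2 ≠ 0 := sub_ne_zero.mpr hab
  rw [deriv_F03 c d ha, deriv_F03 c d hb, mul_assoc (a⁻¹ ^ 2), mul_assoc (b⁻¹ ^ 2)]
  generalize c⁻¹ * d⁻¹ = q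
  field_simp
  ring

/-- The closed formula `F_{0,4}` satisfies the `(g,n) = (0,4)` case of the
differential topological recursion with input `F_{0,3}`. -/
theorem F04_recursion (t1 t2 t3 t4 : ℝ) (h1 : t1 ≠ 0) (h2 : t2 ≠ 0) (h3 : t3 ≠ 0)
    (h4 : t4 ≠ 0) (h12 : t1 ^ 2 ≠ t2 ^ 2) (h13 : t1 ^ 2 ≠ t3 ^ 2)
    (h14 : t1 ^ 2 ≠ t4 ^ 2) :
    deriv (fun s => F04 s t2 t3 t4) t1 =
      -(1 / 16) *
        ((t2 / (t1 ^ 2 - t2 ^ 2) *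
            (((t1 ^ 2 - 1) ^ 3 / t1 ^ 2) * deriv (fun s => F03 s t3 t4) t1 -
              ((t2 ^ 2 - 1) ^ 3 / t2 ^ 2) * deriv (fun s => F03 s t3 t4) t2) +
            ((t1 ^ 2 - 1) ^ 2 / t1 ^ 2) * deriv (fun s => F03 s t3 t4) t1) +
          (t3 / (t1 ^ 2 - t3 ^ 2) *
            (((t1 ^ 2 - 1) ^ 3 / t1 ^ 2) * deriv (fun s => F03 s t2 t4) t1 -
              ((t3 ^ 2 - 1) ^ 3 / t3 ^ 2) * deriv (fun s => F03 t2 s t4) t3) +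
            ((t1 ^ 2 - 1) ^ 2 / t1 ^ 2) * deriv (fun s => F03 s t2 t4) t1) +
          (t4 / (t1 ^ 2 - t4 ^ 2) *
            (((t1 ^ 2 - 1) ^ 3 / t1 ^ 2) * deriv (fun s => F03 s t2 t3) t1 -
              ((t4 ^ 2 - 1) ^ 3 / t4 ^ 2) * deriv (fun s => F03 t2 t3 s) t4) +
            ((t1 ^ 2 - 1) ^ 2 / t1 ^ 2) * deriv (fun s => F03 s t2 t3) t1)) := by
  simp only [F03_swap_left t2 _ t4, F03_rotate t2 t3]
  rw [deriv_F04 h1, F03_recursion_summand t3 t4 h1 h2 h12,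
    F03_recursion_summand t2 t4 h1 h3 h13, F03_recursion_summand t2 t3 h1 h4 h14]
  field_simp
  ring
end

section
/- The closed formula F12 satisfies the (g,n) = (1,2) case of the differential topological recursion with inputs F11 and F03: for all nonzero real t_1, t_2 with t_1² ≠ t_2², ∂F12/∂t_1 (t_1,t_2) = −(1/16) · [ (t_2/(t_1²−t_2²)) · ( ((t_1²−1)³/t_1²)·F11′(t_1) − ((t_2²−1)³/t_2²)·F11′(t_2) ) + ((t_1²−1)²/t_1²)·F11′(t_1) ] − (1/32) · ((t_1²−1)³/t_1²) · (∂²/∂u_1∂u_2) F03(u_1, u_2, t_2) |_{u_1 = u_2 = t_1}. -/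
/-- The Poincaré polynomial `F_{1,1}` of `RG_{1,1}`. -/
noncomputable def F11 (t : ℝ) : ℝ :=
  -(1 / 384) * ((t + 1) ^ 4 / t ^ 2) * (t - 4 + 1 / t)

/-- The Poincaré polynomial `F_{1,2}` of `RG_{1,2}`. -/
noncomputable def F12 (t1 t2 : ℝ) : ℝ :=
  (1 / 2048) *
    (t1 ^ 5 * t2 + t1 * t2 ^ 5 + t1 ^ 3 * t2 ^ 3 / 3 + t1 ^ 5 + t2 ^ 5 -
      6 * (t1 ^ 3 * t2 + t1 * t2 ^ 3) - (17 / 3) * (t1 ^ 3 + t2 ^ 3) +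
      27 * (t1 * t2) + 26 * (t1 + t2) + 128 / 3 + 4 * (t1 / t2 + t2 / t1) +
      26 * (1 / t1 + 1 / t2) + 27 / (t1 * t2) -
      (17 / 3) * (1 / t1 ^ 3 + 1 / t2 ^ 3) -
      6 * (1 / (t1 * t2 ^ 3) + 1 / (t1 ^ 3 * t2)) +
      (1 / t1 ^ 5 + 1 / t2 ^ 5) + (1 / 3) * (1 / (t1 ^ 3 * t2 ^ 3)) +
      (1 / (t1 * t2 ^ 5) + 1 / (t1 ^ 5 * t2)))

theorem hasDerivAt_one_div_pow {t : ℝ} (ht : t ≠ 0) (n : ℕ) :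
    HasDerivAt (fun s : ℝ => 1 / s ^ n) (-n / t ^ (n + 1)) t := by
  rcases n with _ | n
  · simpa using hasDerivAt_const t (1 : ℝ)
  · have h := (hasDerivAt_pow (n + 1) t).inv (pow_ne_zero _ ht)
    simp only [one_div]
    refine h.congr_deriv ?_
    rw [Nat.add_sub_cancel]
    field_simp
    ring

theorem hasDerivAt_F11 {t : ℝ} (ht : t ≠ 0) :
    HasDerivAt F11
      (-(1 / 384) * ((4 * (t + 1) ^ 3 / t ^ 2 - 2 * (t + 1) ^ 4 / t ^ 3) * (t - 4 + 1 / t) +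
        ((t + 1) ^ 4 / t ^ 2) * (1 - 1 / t ^ 2))) t := by
  have hid := hasDerivAt_id' t
  have h := ((((hid.add_const 1).pow 4).mul (hasDerivAt_one_div_pow ht 2)).const_mul
    (-(1 / 384) : ℝ)).mul ((hid.sub_const 4).add (hasDerivAt_one_div_pow ht 1))
  refine (HasDerivAt.congr_of_eventuallyEq h
    (.of_forall fun s => ?_)).congr_deriv ?_
  · simp [F11, div_eq_mul_inv]
  · simp only [Pi.add_apply, Pi.mul_apply, Pi.pow_apply]
    push_cast
    field_simp
    ring

theorem hasDerivAt_F03_snd (t1 t3 : ℝ) {t2 : ℝ} (h2 : t2 ≠ 0) :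
    HasDerivAt (fun s => F03 t1 s t3)
      (-(1 / 16) * (t1 + 1) * (t3 + 1) * (1 - 1 / (t1 * t2 ^ 2 * t3))) t2 := by
  have h := ((hasDerivAt_id' t2).add_const 1).mul
    (((hasDerivAt_one_div_pow h2 1).const_mul (1 / (t1 * t3))).const_add 1)
  refine (HasDerivAt.congr_of_eventuallyEq (h.const_mul (-(1 / 16) * (t1 + 1) * (t3 + 1)))
    (.of_forall fun s => ?_)).congr_deriv ?_
  · simp only [F03, Pi.mul_apply]
    ring
  · simp only [Nat.cast_one]
    have h3 : t2 * t2⁻¹ ^ 2 = t2⁻¹ := by field_simp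
    linear_combination
      ((1 / 16) * (t1 + 1) * (t3 + 1) * (t1 * t3)⁻¹) * h3

theorem deriv_deriv_F03 {t1 t2 : ℝ} (h1 : t1 ≠ 0) (t3 : ℝ) (h2 : t2 ≠ 0) :
    deriv (fun u1 => deriv (fun u2 => F03 u1 u2 t3) t2) t1 =
      -(1 / 16) * (t3 + 1) * (1 + 1 / (t1 ^ 2 * t2 ^ 2 * t3)) := by
  simp only [(hasDerivAt_F03_snd _ t3 h2).deriv]
  have h := ((hasDerivAt_id' t1).add_const 1).mul
    (((hasDerivAt_one_div_pow h1 1).const_mul (-(1 / (t2 ^ 2 * t3)))).const_add 1)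
  refine HasDerivAt.deriv ?_
  refine (HasDerivAt.congr_of_eventuallyEq (h.const_mul (-(1 / 16) * (t3 + 1)))
    (.of_forall fun s => ?_)).congr_deriv ?_
  · simp only [Pi.mul_apply]
    ring
  · simp only [Nat.cast_one]
    have h3 : t1 * t1⁻¹ ^ 2 = t1⁻¹ := by field_simp
    linear_combination
      (-(1 / 16) * (t3 + 1) * (t2 ^ 2 * t3)⁻¹) * h3

theorem hasDerivAt_F12_fst {t1 : ℝ} (h1 : t1 ≠ 0) (t2 : ℝ) :
    HasDerivAt (fun s => F12 s t2)
      ((1 / 2048) *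
        (5 * (t2 + 1) * t1 ^ 4 + 3 * (t2 ^ 3 / 3 - 6 * t2 - 17 / 3) * t1 ^ 2 +
          (t2 ^ 5 - 6 * t2 ^ 3 + 27 * t2 + 26 + 4 / t2) -
          (4 * t2 + 26 + 27 / t2 - 6 / t2 ^ 3 + 1 / t2 ^ 5) / t1 ^ 2 -
          3 * (-(17 / 3) - 6 / t2 + 1 / (3 * t2 ^ 3)) / t1 ^ 4 -
          5 * (1 + 1 / t2) / t1 ^ 6)) t1 := by
  have h := ((((((((hasDerivAt_pow 5 t1).const_mul (t2 + 1)).add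
    ((hasDerivAt_pow 3 t1).const_mul (t2 ^ 3 / 3 - 6 * t2 - 17 / 3))).add
    ((hasDerivAt_id' t1).const_mul (t2 ^ 5 - 6 * t2 ^ 3 + 27 * t2 + 26 + 4 / t2))).add
    ((hasDerivAt_one_div_pow h1 1).const_mul
      (4 * t2 + 26 + 27 / t2 - 6 / t2 ^ 3 + 1 / t2 ^ 5))).add
    ((hasDerivAt_one_div_pow h1 3).const_mul (-(17 / 3) - 6 / t2 + 1 / (3 * t2 ^ 3)))).add
    ((hasDerivAt_one_div_pow h1 5).const_mul (1 + 1 / t2))).add_const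
    (t2 ^ 5 - 17 / 3 * t2 ^ 3 + 26 * t2 + 128 / 3 + 26 / t2 - 17 / 3 / t2 ^ 3 +
      1 / t2 ^ 5)).const_mul (1 / 2048 : ℝ)
  refine (HasDerivAt.congr_of_eventuallyEq h
    (.of_forall fun s => ?_)).congr_deriv ?_
  · simp only [F12, Pi.add_apply]
    ring
  · norm_num
    ring

/-- The closed formula `F_{1,2}` satisfies the `(g,n) = (1,2)` case of the
differential topological recursion with inputs `F_{1,1}` and `F_{0,3}`. -/
theorem F12_recursion (t1 t2 : ℝ) (h1 : t1 ≠ 0) (h2 : t2 ≠ 0)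
    (h12 : t1 ^ 2 ≠ t2 ^ 2) :
    deriv (fun s => F12 s t2) t1 =
      -(1 / 16) *
        (t2 / (t1 ^ 2 - t2 ^ 2) *
            (((t1 ^ 2 - 1) ^ 3 / t1 ^ 2) * deriv F11 t1 -
              ((t2 ^ 2 - 1) ^ 3 / t2 ^ 2) * deriv F11 t2) +
          ((t1 ^ 2 - 1) ^ 2 / t1 ^ 2) * deriv F11 t1) -
      (1 / 32) * ((t1 ^ 2 - 1) ^ 3 / t1 ^ 2) *
        deriv (fun u1 => deriv (fun u2 => F03 u1 u2 t2) t1) t1 := by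
  have h3 : t1 ^ 2 - t2 ^ 2 ≠ 0 := sub_ne_zero.mpr h12
  rw [(hasDerivAt_F12_fst h1 t2).deriv, (hasDerivAt_F11 h1).deriv, (hasDerivAt_F11 h2).deriv,
    deriv_deriv_F03 h1 t2 h1]
  field_simp
  ring
end

section
/- Let f : ℕ × ℕ → ℝ have finite support and let w > 0 be a real number. Then (1/2) · Σ_{p=0}^{∞} e^{−pw} · ( Σ_{(q_1,q_2) ∈ ℕ², q_1+q_2 ≤ p, p ≡ q_1+q_2 (mod 2)} q_1 · q_2 · (p − q_1 − q_2) · f(q_1,q_2) ) = (1/(e^w − e^{−w})²) · Σ_{(q_1,q_2) ∈ ℕ²} q_1 · q_2 · f(q_1,q_2) · e^{−(q_1+q_2)w}, where the sum over p converges absolutely. -/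
/-- The Laplace transform of `p ↦ p - s` over the naturals `p ≥ s` with the parity of `s`. -/
theorem hasSum_exp_mul_sub_of_parity (s : ℕ) {w : ℝ} (hw : 0 < w) :
    HasSum (fun p : ℕ => if s ≤ p ∧ s % 2 = p % 2 then
        Real.exp (-(p : ℝ) * w) * ((p : ℝ) - s) else 0)
      (2 * (Real.exp (-(s : ℝ) * w) / (Real.exp w - Real.exp (-w)) ^ 2)) := by
  have hinj : Function.Injective fun k : ℕ => s + 2 * k := fun a b h => by
    simp only at h
    omega
  rw [← hinj.hasSum_iff]
  · have hr : ‖Real.exp (-(2 * w))‖ < 1 := by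
      rw [Real.norm_eq_abs, Real.abs_exp, Real.exp_lt_one_iff]
      linarith
    have hker : Real.exp (-(2 * w)) / (1 - Real.exp (-(2 * w))) ^ 2 =
        1 / (Real.exp w - Real.exp (-w)) ^ 2 := by
      have h1 : Real.exp (-(2 * w)) = Real.exp (-w) ^ 2 := by
        rw [← Real.exp_nat_mul]
        congr 1
        push_cast
        ring
      have h2 : 1 - Real.exp (-(2 * w)) =
          Real.exp (-w) * (Real.exp w - Real.exp (-w)) := by
        rw [mul_sub, ← Real.exp_add, h1, neg_add_cancel, Real.exp_zero, sq]
      rw [h2, h1]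
      field_simp
    have h := (hasSum_coe_mul_geometric_of_norm_lt_one hr).mul_left
      (2 * Real.exp (-(s : ℝ) * w))
    rw [hker, mul_assoc, mul_one_div] at h
    refine h.congr_fun fun k => ?_
    have hk : s ≤ s + 2 * k ∧ s % 2 = (s + 2 * k) % 2 := by omega
    simp only [Function.comp_apply, if_pos hk]
    have he : Real.exp (-((s + 2 * k : ℕ) : ℝ) * w) =
        Real.exp (-(s : ℝ) * w) * Real.exp (-(2 * w)) ^ k := by
      rw [← Real.exp_nat_mul, ← Real.exp_add]
      congr 1
      push_cast
      ring
    rw [he]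
    push_cast
    ring
  · intro p hp
    refine if_neg fun h => hp ⟨(p - s) / 2, ?_⟩
    simp only
    omega

/-- Laplace-transform summation identity converting the quadratic (pair-of-pants)
terms of the lattice-point recursion into the kernel `1/(e^w − e^{−w})²`: for a
finitely supported `f : ℕ × ℕ → ℝ` and `w > 0`,
`(1/2)·Σ_{p≥0} e^{−pw} Σ_{q₁+q₂≤p, p≡q₁+q₂ (2)} q₁q₂(p−q₁−q₂) f(q₁,q₂)
  = (1/(e^w−e^{−w})²)·Σ_{q₁,q₂} q₁q₂ f(q₁,q₂) e^{−(q₁+q₂)w}`,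
the sum over `p` being absolutely convergent. -/
theorem laplace_pair_of_pants (f : ℕ × ℕ →₀ ℝ) (w : ℝ) (hw : 0 < w) :
    Summable (fun p : ℕ => Real.exp (-(p : ℝ) * w) *
        ∑ q ∈ f.support.filter fun q => q.1 + q.2 ≤ p ∧ (q.1 + q.2) % 2 = p % 2,
          (q.1 : ℝ) * (q.2 : ℝ) * ((p : ℝ) - (q.1 : ℝ) - (q.2 : ℝ)) * f q) ∧
      (1 / 2) * ∑' p : ℕ, Real.exp (-(p : ℝ) * w) *
          ∑ q ∈ f.support.filter fun q => q.1 + q.2 ≤ p ∧ (q.1 + q.2) % 2 = p % 2,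
            (q.1 : ℝ) * (q.2 : ℝ) * ((p : ℝ) - (q.1 : ℝ) - (q.2 : ℝ)) * f q =
        (1 / (Real.exp w - Real.exp (-w)) ^ 2) *
          ∑ q ∈ f.support,
            (q.1 : ℝ) * (q.2 : ℝ) * f q * Real.exp (-((q.1 : ℝ) + (q.2 : ℝ)) * w) := by
  have h : HasSum (fun p : ℕ => Real.exp (-(p : ℝ) * w) *
        ∑ q ∈ f.support.filter fun q => q.1 + q.2 ≤ p ∧ (q.1 + q.2) % 2 = p % 2,
          (q.1 : ℝ) * (q.2 : ℝ) * ((p : ℝ) - (q.1 : ℝ) - (q.2 : ℝ)) * f q)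
      (∑ q ∈ f.support, (q.1 : ℝ) * (q.2 : ℝ) * f q *
        (2 * (Real.exp (-((q.1 + q.2 : ℕ) : ℝ) * w) /
          (Real.exp w - Real.exp (-w)) ^ 2))) := by
    refine HasSum.congr_fun (hasSum_sum
      fun (q : ℕ × ℕ) (_ : q ∈ f.support) =>
        (hasSum_exp_mul_sub_of_parity (q.1 + q.2) hw).mul_left
          ((q.1 : ℝ) * (q.2 : ℝ) * f q)) fun p => ?_
    rw [Finset.sum_filter, Finset.mul_sum]
    refine Finset.sum_congr rfl fun q _ => ?_
    split_ifs
    · push_cast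
      ring
    · simp
  refine ⟨h.summable, ?_⟩
  rw [h.tsum_eq, Finset.mul_sum, Finset.mul_sum]
  refine Finset.sum_congr rfl fun q _ => ?_
  push_cast
  ring
end
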